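/- arXiv:1603.07377 — 3 statements merged into one kernel-verified Lean document; each statement's English description precedes it below -/
import Mathlib

section
/- Suppose P(|G| ≥ μ) = 1 for some constant μ > 0 and E[G²] < ∞. Then as σ → 0: |R(χ*(σ), σ) − M_1(ε)| = O( φ(μ/σ − χ**) ). -/
open MeasureTheory ProbabilityTheory Real Filter Set Asymptotics

noncomputable section

/-- The standard Gaussian measure on `ℝ`. -/
def stdGaussian : Measure ℝ := gaussianReal 0 1

/-- Soft thresholding, i.e. `η₁(u;χ) = sign(u)·max(|u|−χ,0)`. -/
def soft (u χ : ℝ) : ℝ := Real.sign u * max (|u| - χ) 0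

/-- `M₁(ε) = inf_{χ ≥ 0} [(1−ε)·E[η₁(Z;χ)²] + ε(1+χ²)]`, `Z ~ N(0,1)`. -/
def M1 (ε : ℝ) : ℝ :=
  ⨅ χ : NNReal, ((1 - ε) * ∫ z, (soft z (χ:ℝ))^2 ∂stdGaussian + ε * (1 + (χ:ℝ)^2))

/-- The law of `B`: the mixture `(1−ε)δ₀ + ε·g`. -/
def mix (ε : ℝ) (g : Measure ℝ) : Measure ℝ :=
  ENNReal.ofReal (1 - ε) • Measure.dirac (0:ℝ) + ENNReal.ofReal ε • g

/-- `R(χ,σ) = E[(η₁(B/σ+Z;χ) − B/σ)²]` with `B ~ (1−ε)δ₀+εg`, `Z ~ N(0,1)` independent. -/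
def R1 (ε : ℝ) (g : Measure ℝ) (χ σ : ℝ) : ℝ :=
  ∫ b, (∫ z, (soft (b/σ + z) χ - b/σ)^2 ∂stdGaussian) ∂(mix ε g)

/-- `ψ(χ) = (1−ε)·E[η₁(Z;χ)²] + ε(1+χ²)`. -/
def psi (ε χ : ℝ) : ℝ :=
  (1 - ε) * ∫ z, (soft z χ)^2 ∂stdGaussian + ε * (1 + χ^2)

/-- The standard normal density. -/
def phi (x : ℝ) : ℝ := (Real.sqrt (2 * Real.pi))⁻¹ * Real.exp (-x^2/2)

theorem soft_eq {u χ : ℝ} (hχ : 0 ≤ χ) :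
    soft u χ = max (u - χ) 0 - max (-u - χ) 0 := by
  unfold soft
  rcases lt_trichotomy u 0 with h | rfl | h
  · rw [Real.sign_of_neg h, abs_of_neg h, max_eq_right (by linarith : u - χ ≤ 0)]
    ring
  · simp
  · rw [Real.sign_of_pos h, abs_of_pos h, max_eq_right (by linarith : -u - χ ≤ 0)]
    ring

theorem soft_sq {u χ : ℝ} (hχ : 0 ≤ χ) : soft u χ ^ 2 = max (|u| - χ) 0 ^ 2 := by
  unfold soft
  rcases lt_trichotomy u 0 with h | rfl | h
  · rw [Real.sign_of_neg h]; ring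
  · simp [hχ]
  · rw [Real.sign_of_pos h]; ring

theorem continuous_soft {χ : ℝ} (hχ : 0 ≤ χ) : Continuous fun u => soft u χ := by
  simp only [soft_eq hχ]
  fun_prop

theorem soft_neg (u χ : ℝ) : soft (-u) χ = -soft u χ := by
  simp [soft, Real.sign_neg]

theorem soft_midpoint_sq_le {u x y : ℝ} (hx : 0 ≤ x) (hy : 0 ≤ y) :
    soft u ((x + y) / 2) ^ 2 ≤ (soft u x ^ 2 + soft u y ^ 2) / 2 := by
  rw [soft_sq hx, soft_sq hy, soft_sq (by positivity)]
  have h1 : max (|u| - (x + y) / 2) 0 ≤ (max (|u| - x) 0 + max (|u| - y) 0) / 2 := by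
    apply max_le
    · linarith [le_max_left (|u| - x) 0, le_max_left (|u| - y) 0]
    · positivity
  have h0 : 0 ≤ max (|u| - (x + y) / 2) 0 := le_max_right _ _
  nlinarith [sq_nonneg (max (|u| - x) 0 - max (|u| - y) 0)]

theorem sq_soft_sub_le {a z χ : ℝ} (hχ : 0 ≤ χ) :
    (soft (a + z) χ - a) ^ 2 ≤ 2 * z ^ 2 + 2 * χ ^ 2 := by
  have h : |soft (a + z) χ - a| ≤ |z| + χ := by
    rw [soft_eq hχ, abs_le]
    rcases abs_cases z with ⟨h, _⟩ | ⟨h, _⟩ <;>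
    rcases max_cases (a + z - χ) 0 with ⟨h1, _⟩ | ⟨h1, _⟩ <;>
    rcases max_cases (-(a + z) - χ) 0 with ⟨h2, _⟩ | ⟨h2, _⟩ <;>
    rw [h, h1, h2] <;> constructor <;> linarith
  have h2 := pow_le_pow_left₀ (abs_nonneg _) h 2
  rw [sq_abs] at h2
  nlinarith [sq_abs z, sq_nonneg (|z| - χ)]

theorem sq_soft_sub_le_sq_sub {a z χ : ℝ} (ha : 0 ≤ a) (hχ : 0 ≤ χ) :
    (soft (a + z) χ - a) ^ 2 ≤ (z - χ) ^ 2 := by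
  rw [soft_eq hχ]
  rcases max_cases (a + z - χ) 0 with ⟨h1, _⟩ | ⟨h1, _⟩ <;>
  rcases max_cases (-(a + z) - χ) 0 with ⟨h2, _⟩ | ⟨h2, _⟩ <;>
  rw [h1, h2] <;> nlinarith

theorem sq_min_le_sq_soft_sub {a z χ : ℝ} (ha : 0 ≤ a) (hχ : 0 ≤ χ) (hz : z ≤ 0) :
    min a χ ^ 2 ≤ (soft (a + z) χ - a) ^ 2 := by
  have h : min a χ ≤ a - soft (a + z) χ := by
    rw [soft_eq hχ]
    rcases max_cases (a + z - χ) 0 with ⟨h1, _⟩ | ⟨h1, _⟩ <;>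
    rcases max_cases (-(a + z) - χ) 0 with ⟨h2, _⟩ | ⟨h2, _⟩ <;>
    rw [h1, h2] <;> linarith [min_le_left a χ, min_le_right a χ]
  have h0 : 0 ≤ min a χ := le_min ha hχ
  nlinarith

theorem phi_nonneg (x : ℝ) : 0 ≤ phi x := by unfold phi; positivity

theorem phi_add (x s : ℝ) : phi (x + s) = phi x * (Real.exp (-(x * s)) * Real.exp (-s ^ 2 / 2)) := by
  unfold phi
  rw [← Real.exp_add, mul_assoc, ← Real.exp_add]
  ring_nf

theorem phi_neg (x : ℝ) : phi (-x) = phi x := by simp [phi]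

theorem phi_le_phi {x y : ℝ} (hx : 0 ≤ x) (hxy : x ≤ y) : phi y ≤ phi x := by
  unfold phi
  gcongr

theorem phi_le_exp (x : ℝ) : phi x ≤ Real.exp (-x ^ 2 / 2) := by
  unfold phi
  have : (√(2 * Real.pi))⁻¹ ≤ 1 := by
    apply inv_le_one_of_one_le₀
    rw [Real.one_le_sqrt]
    linarith [Real.pi_gt_three]
  exact mul_le_of_le_one_left (Real.exp_nonneg _) this

instance : IsProbabilityMeasure stdGaussian := by
  unfold _root_.stdGaussian; infer_instance

theorem integral_stdGaussian (f : ℝ → ℝ) : ∫ z, f z ∂stdGaussian = ∫ z, phi z * f z := by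
  unfold _root_.stdGaussian
  rw [integral_gaussianReal_eq_integral_smul one_ne_zero]
  simp [gaussianPDFReal, phi]

theorem integral_stdGaussian_neg (f : ℝ → ℝ) :
    ∫ z, f (-z) ∂stdGaussian = ∫ z, f z ∂stdGaussian := by
  rw [integral_stdGaussian, integral_stdGaussian, ← integral_neg_eq_self]
  simp [phi_neg]

theorem memLp_id_stdGaussian : MemLp id 2 stdGaussian := by
  unfold _root_.stdGaussian
  exact memLp_id_gaussianReal 2

theorem integrable_sq_stdGaussian : Integrable (fun z : ℝ => z ^ 2) stdGaussian :=
  memLp_id_stdGaussian.integrable_sq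

theorem integrable_id_stdGaussian : Integrable (fun z : ℝ => z) stdGaussian :=
  memLp_id_stdGaussian.integrable (by norm_num)

theorem integrable_sq_sub_stdGaussian (χ : ℝ) :
    Integrable (fun z : ℝ => (z - χ) ^ 2) stdGaussian :=
  (memLp_id_stdGaussian.sub (memLp_const χ)).integrable_sq

theorem integral_sq_sub_stdGaussian (χ : ℝ) :
    ∫ z, (z - χ) ^ 2 ∂stdGaussian = 1 + χ ^ 2 := by
  have h1 : ∫ z, z ∂stdGaussian = 0 := by
    unfold _root_.stdGaussian; simp
  have h2 : ∫ z, z ^ 2 ∂stdGaussian = 1 := by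
    have h := variance_fun_id_gaussianReal (μ := 0) (v := 1)
    rw [variance_eq_integral (by fun_prop)] at h
    simpa [_root_.stdGaussian] using h
  have : ∀ z : ℝ, (z - χ) ^ 2 = (z ^ 2 - (2 * χ) * z) + χ ^ 2 := fun z => by ring
  simp only [this]
  have hi : Integrable (fun z : ℝ => 2 * χ * z) stdGaussian :=
    integrable_id_stdGaussian.const_mul _
  have hs : Integrable (fun z : ℝ => z ^ 2 - 2 * χ * z) stdGaussian :=
    integrable_sq_stdGaussian.sub hi
  rw [integral_add hs (integrable_const _), integral_sub integrable_sq_stdGaussian hi,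
    integral_const_mul, h1, h2]
  simp

/-- The risk `E[(η₁(a + Z; χ) - a)²]` of soft thresholding at the signal `a`. -/
def softRisk (χ a : ℝ) : ℝ := ∫ z, (soft (a + z) χ - a) ^ 2 ∂stdGaussian

theorem integrable_softRisk {χ : ℝ} (hχ : 0 ≤ χ) (a : ℝ) :
    Integrable (fun z => (soft (a + z) χ - a) ^ 2) stdGaussian := by
  have hc := continuous_soft hχ
  refine Integrable.mono' (g := fun z => 2 * z ^ 2 + 2 * χ ^ 2)
    ((integrable_sq_stdGaussian.const_mul 2).add (integrable_const _))
    (Continuous.aestronglyMeasurable (by fun_prop)) (ae_of_all _ fun z => ?_)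
  rw [Real.norm_of_nonneg (sq_nonneg _)]
  exact sq_soft_sub_le hχ

theorem softRisk_nonneg (χ a : ℝ) : 0 ≤ softRisk χ a :=
  integral_nonneg fun _ => sq_nonneg _

theorem softRisk_neg (χ a : ℝ) : softRisk χ (-a) = softRisk χ a := by
  unfold softRisk
  rw [← integral_stdGaussian_neg]
  congr 1 with z
  rw [show -a + -z = -(a + z) by ring, soft_neg]
  ring

theorem softRisk_abs (χ a : ℝ) : softRisk χ |a| = softRisk χ a := by
  rcases abs_cases a with ⟨h, _⟩ | ⟨h, _⟩ <;> simp [h, softRisk_neg]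

theorem softRisk_le {χ : ℝ} (hχ : 0 ≤ χ) (a : ℝ) : softRisk χ a ≤ 1 + χ ^ 2 := by
  rw [← softRisk_abs, ← integral_sq_sub_stdGaussian]
  exact integral_mono (integrable_softRisk hχ _) (integrable_sq_sub_stdGaussian χ)
    fun z => sq_soft_sub_le_sq_sub (abs_nonneg a) hχ

theorem sq_min_le_two_mul_softRisk {χ a : ℝ} (hχ : 0 ≤ χ) (ha : 0 ≤ a) :
    min a χ ^ 2 ≤ 2 * softRisk χ a := by
  have hint := integrable_softRisk hχ a
  have hneg : Integrable (fun z => (soft (a + -z) χ - a) ^ 2) stdGaussian := by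
    have h := integrable_softRisk hχ (-a)
    refine h.congr (ae_of_all _ fun z => ?_)
    simp only
    rw [show a + -z = -(-a + z) by ring, soft_neg]
    ring
  have h : 2 * softRisk χ a =
      ∫ z, ((soft (a + z) χ - a) ^ 2 + (soft (a + -z) χ - a) ^ 2) ∂stdGaussian := by
    rw [integral_add hint hneg,
      integral_stdGaussian_neg (fun z => (soft (a + z) χ - a) ^ 2), softRisk]
    ring
  rw [h]
  calc min a χ ^ 2 = ∫ _, min a χ ^ 2 ∂stdGaussian := by simp
    _ ≤ _ := by
      refine integral_mono (integrable_const _) (hint.add hneg) fun z => ?_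
      simp only
      rcases le_total z 0 with hz | hz
      · linarith [sq_min_le_sq_soft_sub ha hχ hz, sq_nonneg (soft (a + -z) χ - a)]
      · linarith [sq_min_le_sq_soft_sub ha hχ (neg_nonpos.2 hz), sq_nonneg (soft (a + z) χ - a)]

theorem measurable_softRisk {χ : ℝ} (hχ : 0 ≤ χ) : Measurable (softRisk χ) := by
  have hc := continuous_soft hχ
  have : StronglyMeasurable (fun p : ℝ × ℝ => (soft (p.1 + p.2) χ - p.1) ^ 2) :=
    Continuous.stronglyMeasurable (by fun_prop)
  exact this.integral_prod_right'.measurable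

theorem integrable_four_add_sq_mul_exp :
    Integrable fun s : ℝ => (4 + s ^ 2) * Real.exp (-s ^ 2 / 2) := by
  have h0 := integrable_exp_neg_mul_sq (b := 1 / 2) (by norm_num)
  have h2 := integrable_rpow_mul_exp_neg_mul_sq (b := 1 / 2) (by norm_num) (s := 2) (by norm_num)
  refine ((h0.const_mul 4).add h2).congr (ae_of_all _ fun s => ?_)
  simp only [Pi.add_apply, Real.rpow_two]
  rw [show -(1 / 2) * s ^ 2 = -s ^ 2 / 2 by ring]
  ring

theorem phi_mul_gap_le {χ a z : ℝ} (hχ : 0 ≤ χ) (ha : 2 * χ ≤ a) :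
    phi z * ((z - χ) ^ 2 - (soft (a + z) χ - a) ^ 2) ≤
      phi (a - χ) * ((4 + (χ - a - z) ^ 2) * Real.exp (-(χ - a - z) ^ 2 / 2)) := by
  rcases le_total (χ - a) z with hz | hz
  · have : (soft (a + z) χ - a) ^ 2 = (z - χ) ^ 2 := by
      rw [soft_eq hχ, max_eq_left (by linarith), max_eq_right (by linarith)]
      ring
    rw [this, sub_self, mul_zero]
    have := phi_nonneg (a - χ)
    positivity
  · obtain ⟨s, rfl⟩ : ∃ s, z = -((a - χ) + s) := ⟨χ - a - z, by ring⟩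
    have hs : 0 ≤ s := by linarith
    rw [show χ - a - -((a - χ) + s) = s by ring, phi_neg, phi_add, mul_assoc]
    refine mul_le_mul_of_nonneg_left ?_ (phi_nonneg _)
    have hD : (-((a - χ) + s) - χ) ^ 2 - (soft (a + -((a - χ) + s)) χ - a) ^ 2
        ≤ 2 * (a * s) + s ^ 2 := by
      have : a ^ 2 ≤ (soft (a + -((a - χ) + s)) χ - a) ^ 2 := by
        rw [soft_eq hχ, max_eq_right (by linarith)]
        have := le_max_right (-(a + -((a - χ) + s)) - χ) 0
        nlinarith
      nlinarith
    have hexp : Real.exp (-((a - χ) * s)) ≤ Real.exp (-(a * s / 2)) :=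
      Real.exp_le_exp.2 (by nlinarith)
    have hexp1 : Real.exp (-(a * s / 2)) ≤ 1 := Real.exp_le_one_iff.2 (by nlinarith)
    have hexp2 : a * s / 2 * Real.exp (-(a * s / 2)) ≤ 1 := by
      rw [Real.exp_neg, ← div_eq_mul_inv, div_le_one (Real.exp_pos _)]
      linarith [Real.add_one_le_exp (a * s / 2)]
    have has : 0 ≤ 2 * (a * s) + s ^ 2 := by nlinarith
    calc _ = (Real.exp (-((a - χ) * s)) *
          ((-((a - χ) + s) - χ) ^ 2 - (soft (a + -((a - χ) + s)) χ - a) ^ 2)) *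
            Real.exp (-s ^ 2 / 2) := by ring
      _ ≤ _ := by
        refine mul_le_mul_of_nonneg_right ?_ (Real.exp_nonneg _)
        calc _ ≤ Real.exp (-((a - χ) * s)) * (2 * (a * s) + s ^ 2) := by gcongr
          _ ≤ Real.exp (-(a * s / 2)) * (2 * (a * s) + s ^ 2) := by gcongr
          _ ≤ 4 + s ^ 2 := by nlinarith [sq_nonneg s]

/-- The constant in the Gaussian tail bound for the gap `1 + χ² - E[(η₁(a + Z; χ) - a)²]`. -/
def gapConst : ℝ := ∫ s : ℝ, (4 + s ^ 2) * Real.exp (-s ^ 2 / 2)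

theorem gapConst_nonneg : 0 ≤ gapConst := integral_nonneg fun _ => by positivity

theorem integrable_stdGaussian_iff (f : ℝ → ℝ) :
    Integrable f stdGaussian ↔ Integrable fun z => phi z * f z := by
  unfold _root_.stdGaussian
  rw [gaussianReal_of_var_ne_zero _ one_ne_zero]
  have h : gaussianPDF 0 1 = fun x => ENNReal.ofReal (phi x) := by
    ext x
    simp [gaussianPDF, gaussianPDFReal, phi]
  have hm : Measurable phi := by unfold phi; fun_prop
  rw [h, integrable_withDensity_iff_integrable_smul' (by fun_prop) (by simp)]
  simp [ENNReal.toReal_ofReal (phi_nonneg _)]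

theorem one_add_sq_sub_softRisk_le {χ a : ℝ} (hχ : 0 ≤ χ) (ha : 2 * χ ≤ a) :
    1 + χ ^ 2 - softRisk χ a ≤ gapConst * phi (a - χ) := by
  have hi := (integrable_sq_sub_stdGaussian χ).sub (integrable_softRisk hχ a)
  rw [← integral_sq_sub_stdGaussian, softRisk,
    ← integral_sub (integrable_sq_sub_stdGaussian χ) (integrable_softRisk hχ a),
    integral_stdGaussian]
  calc _ ≤ ∫ z, phi (a - χ) *
        ((4 + (χ - a - z) ^ 2) * Real.exp (-(χ - a - z) ^ 2 / 2)) := by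
        refine integral_mono ((integrable_stdGaussian_iff _).1 hi) ?_
          fun z => phi_mul_gap_le hχ ha
        exact (integrable_four_add_sq_mul_exp.comp_sub_left (χ - a)).const_mul _
    _ = gapConst * phi (a - χ) := by
        rw [integral_const_mul, integral_sub_left_eq_self
          (fun s : ℝ => (4 + s ^ 2) * Real.exp (-s ^ 2 / 2)) volume (χ - a), gapConst, mul_comm]

theorem psi_eq (ε χ : ℝ) : psi ε χ = (1 - ε) * softRisk χ 0 + ε * (1 + χ ^ 2) := by
  simp [psi, softRisk]

theorem softRisk_zero_midpoint_le {x y : ℝ} (hx : 0 ≤ x) (hy : 0 ≤ y) :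
    softRisk ((x + y) / 2) 0 ≤ (softRisk x 0 + softRisk y 0) / 2 := by
  unfold softRisk
  rw [← integral_add (integrable_softRisk hx 0) (integrable_softRisk hy 0), ← integral_div]
  refine integral_mono (integrable_softRisk (by positivity) 0)
    (((integrable_softRisk hx 0).add (integrable_softRisk hy 0)).div_const 2) fun z => ?_
  simpa using soft_midpoint_sq_le hx hy

theorem sq_sub_le_psi_sub_psi {ε x y : ℝ} (hε : ε ≤ 1) (hx : 0 ≤ x) (hy : 0 ≤ y)
    (hmin : IsMinOn (psi ε) (Ici 0) y) : ε / 2 * (x - y) ^ 2 ≤ psi ε x - psi ε y := by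
  have h := hmin (show (x + y) / 2 ∈ Ici (0 : ℝ) from by simp; positivity)
  simp only [mem_ofPred_eq, psi_eq] at h
  rw [psi_eq, psi_eq]
  nlinarith [mul_le_mul_of_nonneg_left (softRisk_zero_midpoint_le hx hy) (sub_nonneg.2 hε)]

theorem M1_eq_of_isMinOn {ε y : ℝ} (hy : 0 ≤ y) (hmin : IsMinOn (psi ε) (Ici 0) y) :
    M1 ε = psi ε y := by
  have hle : ∀ χ : NNReal, psi ε y ≤ psi ε χ := fun χ => hmin χ.2
  refine le_antisymm ?_ (le_ciInf hle)
  exact ciInf_le (f := fun χ : NNReal => psi ε χ) ⟨psi ε y, by rintro _ ⟨χ, rfl⟩; exact hle χ⟩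
    ⟨y, hy⟩

theorem psi_zero (ε : ℝ) : psi ε 0 = 1 := by
  have h : ∀ z : ℝ, soft z 0 = z := fun z => by
    rcases le_total z 0 with h | h <;> simp [soft_eq, h]
  have h2 := integral_sq_sub_stdGaussian 0
  simp only [sub_zero] at h2
  simp [psi, h, h2]

theorem integrable_softRisk_div {χ : ℝ} (hχ : 0 ≤ χ) (σ : ℝ) (ν : Measure ℝ)
    [IsFiniteMeasure ν] : Integrable (fun b => softRisk χ (b / σ)) ν := by
  refine Integrable.of_bound
    ((measurable_softRisk hχ).comp (measurable_id.div_const σ)).aestronglyMeasurable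
    (1 + χ ^ 2) (ae_of_all _ fun b => ?_)
  rw [Real.norm_of_nonneg (softRisk_nonneg _ _)]
  exact softRisk_le hχ _

theorem R1_eq {ε χ σ : ℝ} (hε : ε ∈ Ioo (0 : ℝ) 1) (hχ : 0 ≤ χ) (g : Measure ℝ)
    [IsProbabilityMeasure g] :
    R1 ε g χ σ = (1 - ε) * softRisk χ 0 + ε * ∫ b, softRisk χ (b / σ) ∂g := by
  change ∫ b, softRisk χ (b / σ) ∂(mix ε g) = _
  rw [mix, integral_add_measure
    ((integrable_softRisk_div hχ σ _).smul_measure ENNReal.ofReal_ne_top)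
    ((integrable_softRisk_div hχ σ _).smul_measure ENNReal.ofReal_ne_top),
    integral_smul_measure, integral_smul_measure, integral_dirac,
    ENNReal.toReal_ofReal (by linarith [hε.2]), ENNReal.toReal_ofReal hε.1.le]
  simp

theorem R1_le_psi {ε χ σ : ℝ} (hε : ε ∈ Ioo (0 : ℝ) 1) (hχ : 0 ≤ χ) (g : Measure ℝ)
    [IsProbabilityMeasure g] : R1 ε g χ σ ≤ psi ε χ := by
  rw [R1_eq hε hχ, psi_eq]
  have : ∫ b, softRisk χ (b / σ) ∂g ≤ ∫ _, (1 + χ ^ 2) ∂g :=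
    integral_mono (integrable_softRisk_div hχ σ g) (integrable_const _) fun b => softRisk_le hχ _
  rw [integral_const, probReal_univ, one_smul] at this
  nlinarith [hε.1]

theorem ae_div_le_abs_div {μ σ : ℝ} (hσ : 0 < σ) {g : Measure ℝ} [IsProbabilityMeasure g]
    (hg : g {x : ℝ | μ ≤ |x|} = 1) : ∀ᵐ b ∂g, μ / σ ≤ |b / σ| := by
  have hm : MeasurableSet {x : ℝ | μ ≤ |x|} := measurableSet_le (by fun_prop) (by fun_prop)
  filter_upwards [(mem_ae_iff_prob_eq_one hm).2 hg] with b hb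
  rw [abs_div, abs_of_pos hσ]
  exact div_le_div_of_nonneg_right hb hσ.le

theorem psi_sub_R1_le {ε χ μ σ : ℝ} (hε : ε ∈ Ioo (0 : ℝ) 1) (hχ : 0 ≤ χ) (hσ : 0 < σ)
    {g : Measure ℝ} [IsProbabilityMeasure g] (hg : g {x : ℝ | μ ≤ |x|} = 1)
    (hμ : 2 * χ ≤ μ / σ) : psi ε χ - R1 ε g χ σ ≤ gapConst * phi (μ / σ - χ) := by
  rw [R1_eq hε hχ, psi_eq]
  have h : ∫ _, (1 + χ ^ 2 - gapConst * phi (μ / σ - χ)) ∂g ≤ ∫ b, softRisk χ (b / σ) ∂g := by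
    refine integral_mono_ae (integrable_const _) (integrable_softRisk_div hχ σ g) ?_
    filter_upwards [ae_div_le_abs_div hσ hg] with b hb
    rw [← softRisk_abs]
    have h1 := one_add_sq_sub_softRisk_le hχ (hμ.trans hb)
    have h2 := mul_le_mul_of_nonneg_left
      (phi_le_phi (show 0 ≤ μ / σ - χ by linarith) (sub_le_sub_right hb χ)) gapConst_nonneg
    linarith
  rw [integral_const, probReal_univ, one_smul] at h
  have := mul_nonneg gapConst_nonneg (phi_nonneg (μ / σ - χ))
  nlinarith [hε.1, hε.2]

theorem sq_min_le_R1 {ε χ μ σ : ℝ} (hε : ε ∈ Ioo (0 : ℝ) 1) (hχ : 0 ≤ χ) (hσ : 0 < σ)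
    (hμ : 0 < μ) {g : Measure ℝ} [IsProbabilityMeasure g] (hg : g {x : ℝ | μ ≤ |x|} = 1) :
    ε / 2 * min (μ / σ) χ ^ 2 ≤ R1 ε g χ σ := by
  rw [R1_eq hε hχ]
  have h : ∫ _, (min (μ / σ) χ ^ 2 / 2) ∂g ≤ ∫ b, softRisk χ (b / σ) ∂g := by
    refine integral_mono_ae (integrable_const _) (integrable_softRisk_div hχ σ g) ?_
    filter_upwards [ae_div_le_abs_div hσ hg] with b hb
    rw [← softRisk_abs]
    have h1 := sq_min_le_two_mul_softRisk hχ (abs_nonneg (b / σ))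
    have h2 : min (μ / σ) χ ^ 2 ≤ min |b / σ| χ ^ 2 := by gcongr
    linarith
  rw [integral_const, probReal_univ, one_smul] at h
  have := softRisk_nonneg χ 0
  nlinarith [hε.1, hε.2]

theorem phi_sub_le {A x y L : ℝ} (hx : 0 ≤ x) (hy : 0 ≤ y) (hxA : x ≤ A) (hyA : y ≤ A)
    (hL : |x - y| * A ≤ L) : phi (A - x) ≤ Real.exp L * phi (A - y) := by
  have h : -(A - x) ^ 2 / 2 ≤ L + -(A - y) ^ 2 / 2 := by
    rcases abs_cases (x - y) with ⟨h, _⟩ | ⟨h, _⟩ <;> rw [h] at hL <;> nlinarith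
  unfold phi
  calc _ ≤ (√(2 * Real.pi))⁻¹ * Real.exp (L + -(A - y) ^ 2 / 2) := by gcongr
    _ = _ := by rw [Real.exp_add]; ring

theorem sq_mul_phi_sub_le {A x : ℝ} (hA : 0 < A) (hx : 2 * x ≤ A) :
    A ^ 2 * phi (A - x) ≤ 8 := by
  have h : phi (A - x) ≤ Real.exp (-(A ^ 2 / 8)) :=
    (phi_le_exp _).trans (Real.exp_le_exp.2 (by nlinarith))
  have h2 : A ^ 2 / 8 * Real.exp (-(A ^ 2 / 8)) ≤ 1 := by
    rw [Real.exp_neg, ← div_eq_mul_inv, div_le_one (Real.exp_pos _)]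
    linarith [Real.add_one_le_exp (A ^ 2 / 8)]
  nlinarith [sq_nonneg A]

/-- If `P(|G| ≥ μ) = 1` for some `μ > 0` and `E[G²] < ∞`, then as `σ → 0⁺`:
`|R(χ*(σ),σ) − M₁(ε)| = O(φ(μ/σ − χ**))`, where `χ*(σ)` is the minimizer of `χ ↦ R(χ,σ)`
over `[0,∞)` and `χ**` is the unique minimizer of `ψ` over `[0,∞)`. -/
theorem risk_convergence_rate
    (ε μ : ℝ) (hε : ε ∈ Ioo (0:ℝ) 1) (hμ : 0 < μ)
    (g : Measure ℝ) [IsProbabilityMeasure g] (hg0 : g {0} = 0)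
    (hG2 : Integrable (fun x => x^2) g)
    (hGμ : g {x : ℝ | μ ≤ |x|} = 1)
    (χstar : ℝ → ℝ)
    (hχstar : ∀ σ, 0 < σ → χstar σ ∈ Ici (0:ℝ) ∧
      IsMinOn (fun χ => R1 ε g χ σ) (Ici 0) (χstar σ))
    (χss : ℝ) (hχss0 : χss ∈ Ici (0:ℝ)) (hχssmin : IsMinOn (psi ε) (Ici 0) χss)
    (hχssuniq : ∀ c' ∈ Ici (0:ℝ), IsMinOn (psi ε) (Ici 0) c' → c' = χss) :
    (fun σ => |R1 ε g (χstar σ) σ - M1 ε|)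
      =O[nhdsWithin (0:ℝ) (Ioi 0)] (fun σ => phi (μ/σ - χss)) := by
  set L : ℝ := √(16 * gapConst / ε)
  refine IsBigO.of_bound (gapConst * Real.exp L) ?_
  have hA : Tendsto (fun σ : ℝ => μ / σ) (nhdsWithin 0 (Ioi 0)) atTop :=
    tendsto_inv_nhdsGT_zero.const_mul_atTop hμ
  filter_upwards [self_mem_nhdsWithin, hA.eventually_ge_atTop (2 * √(2 / ε)),
    hA.eventually_ge_atTop χss] with σ hσ hA1 hA2
  have hσ : 0 < σ := hσ
  obtain ⟨hx, hxmin⟩ := hχstar σ hσ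
  generalize χstar σ = x at hx hxmin ⊢
  rw [mem_Ici] at hx hχss0
  have hApos : 0 < μ / σ := div_pos hμ hσ
  have hRle : R1 ε g x σ ≤ psi ε χss := (hxmin hχss0).trans (R1_le_psi hε hχss0 g)
  have hpsi1 : psi ε χss ≤ 1 := psi_zero ε ▸ hχssmin self_mem_Ici
  have hmin : min (μ / σ) x ≤ √(2 / ε) := by
    apply Real.le_sqrt_of_sq_le
    rw [le_div_iff₀ hε.1]
    linarith [sq_min_le_R1 hε hx hσ hμ hGμ]
  have hK : 0 < √(2 / ε) := Real.sqrt_pos.2 (div_pos two_pos hε.1)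
  have hxA : 2 * x ≤ μ / σ := by
    rcases min_le_iff.1 hmin with h | h <;> linarith
  have hgap := psi_sub_R1_le hε hx hσ hGμ hxA
  have hquad := sq_sub_le_psi_sub_psi hε.2.le hx hχss0 hχssmin
  have hL : |x - χss| * (μ / σ) ≤ L := by
    apply Real.le_sqrt_of_sq_le
    rw [le_div_iff₀ hε.1, mul_pow, sq_abs]
    have h1 : ε / 2 * (x - χss) ^ 2 ≤ gapConst * phi (μ / σ - x) := by linarith
    nlinarith [mul_le_mul_of_nonneg_left h1 (sq_nonneg (μ / σ)),
      mul_le_mul_of_nonneg_left (sq_mul_phi_sub_le hApos hxA) gapConst_nonneg]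
  have hphi := phi_sub_le hx hχss0 (by linarith) hA2 hL
  have hmono : psi ε χss ≤ psi ε x := hχssmin hx
  rw [M1_eq_of_isMinOn hχss0 hχssmin, Real.norm_of_nonneg (abs_nonneg _),
    Real.norm_of_nonneg (phi_nonneg _), abs_of_nonpos (by linarith), mul_assoc]
  linarith [mul_le_mul_of_nonneg_left hphi gapConst_nonneg]
end
end

section
/- For every q ∈ (1,2), the function (u,χ) ↦ η_q(u;χ) is differentiable at every point of ℝ × (0,∞) with continuous partial derivatives there; moreover, for every fixed χ > 0, the function u ↦ ∂₂η_q(u;χ) (the partial derivative of η_q with respect to χ) is differentiable at every u ∈ ℝ. -/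
open MeasureTheory Real Filter Set

noncomputable section

/-- `IsProx q χ u v` : `v` minimizes `z ↦ (1/2)(u−z)² + χ|z|^q`,
i.e. `v = η_q(u;χ)` is the proximal operator of `χ|·|^q` at `u`. -/
def IsProx (q χ u v : ℝ) : Prop :=
  ∀ z : ℝ, (1/2) * (u - v)^2 + χ * |v| ^ q ≤ (1/2) * (u - z)^2 + χ * |z| ^ q

/-- A product `h x * x` with `h` continuous at `0` is differentiable at `0`. -/
theorem hasDerivAt_mul_self_zero {h : ℝ → ℝ} (hh : ContinuousAt h 0) :
    HasDerivAt (fun x => h x * x) (h 0) 0 := by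
  rw [hasDerivAt_iff_tendsto_slope]
  refine (hh.tendsto.mono_left nhdsWithin_le_nhds).congr' ?_
  filter_upwards [self_mem_nhdsWithin] with x hx
  have hx' : x ≠ 0 := hx
  simp [slope_def_field, hx']

theorem differentiableAt_abs_rpow_of_ne {r x : ℝ} (hx : x ≠ 0) :
    DifferentiableAt ℝ (fun y : ℝ => |y| ^ r) x :=
  (differentiableAt_abs hx).rpow_const (Or.inl (abs_ne_zero.mpr hx))

theorem continuous_abs_rpow {r : ℝ} (hr : 0 < r) : Continuous (fun y : ℝ => |y| ^ r) :=
  continuous_abs.rpow_const fun _ => Or.inr hr.le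

theorem hasDerivAt_abs_rpow_mul_self {r : ℝ} (hr : 0 < r) (x : ℝ) :
    HasDerivAt (fun y : ℝ => |y| ^ r * y) ((r + 1) * |x| ^ r) x := by
  rcases eq_or_ne x 0 with rfl | hx
  · simpa [Real.zero_rpow hr.ne'] using
      hasDerivAt_mul_self_zero (continuous_abs_rpow hr).continuousAt
  · have key : ∀ c : ℝ, c * x = |x| → HasDerivAt (fun y : ℝ => |y|) c x →
        HasDerivAt (fun y : ℝ => |y| ^ r * y) ((r + 1) * |x| ^ r) x := by
      intro c hc h
      refine ((h.rpow_const (p := r) (Or.inl (abs_ne_zero.mpr hx))).mul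
        (hasDerivAt_id' x)).congr_deriv ?_
      have h2 : |x| ^ (r - 1) * |x| = |x| ^ r := by
        rw [← Real.rpow_add_one (abs_ne_zero.mpr hx)]; ring_nf
      rw [← h2, ← hc]
      ring
    rcases hx.lt_or_gt with hx | hx
    · exact key (-1) (by rw [abs_of_neg hx]; ring) (hasDerivAt_abs_neg hx)
    · exact key 1 (by rw [abs_of_pos hx]; ring) (hasDerivAt_abs_pos hx)

theorem monotone_abs_rpow_mul_self {r : ℝ} (hr : 0 < r) :
    Monotone (fun y : ℝ => |y| ^ r * y) :=
  monotone_of_deriv_nonneg (fun x => (hasDerivAt_abs_rpow_mul_self hr x).differentiableAt)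
    fun x => by rw [(hasDerivAt_abs_rpow_mul_self hr x).deriv]; positivity

/-- Stationarity of the proximal point. -/
theorem IsProx.eq_add {q χ u v : ℝ} (hq : 1 < q) (h : IsProx q χ u v) :
    u = v + χ * q * (|v| ^ (q - 2) * v) := by
  have hd : HasDerivAt (fun z : ℝ => (1 / 2) * (u - z) ^ 2 + χ * |z| ^ q)
      ((1 / 2) * (2 * (u - v) * (-1)) + χ * (q * |v| ^ (q - 2) * v)) v := by
    have h1 := (((hasDerivAt_id' v).const_sub u).pow 2).const_mul (1 / 2 : ℝ)
    have h2 := (hasDerivAt_abs_rpow v hq).const_mul χ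
    refine (h1.add h2).congr_deriv ?_
    norm_num
  have hmin : IsLocalMin (fun z : ℝ => (1 / 2) * (u - z) ^ 2 + χ * |z| ^ q) v :=
    Filter.Eventually.of_forall h
  have := hmin.hasDerivAt_eq_zero hd
  linarith

/-- `w ↦ |w|^((2-q)/(q-1)) w` inverts `v ↦ |v|^(q-2) v`. -/
theorem abs_rpow_mul_self_inverse {q : ℝ} (hq : 1 < q) (v : ℝ) :
    |(|v| ^ (q - 2) * v)| ^ ((2 - q) / (q - 1)) * (|v| ^ (q - 2) * v) = v := by
  rcases eq_or_ne v 0 with rfl | hv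
  · simp
  · have hv' : 0 < |v| := abs_pos.mpr hv
    have hq' : q - 1 ≠ 0 := by linarith
    have h1 : |(|v| ^ (q - 2) * v)| = |v| ^ (q - 1) := by
      rw [abs_mul, abs_of_nonneg (by positivity : 0 ≤ |v| ^ (q - 2)),
        ← Real.rpow_add_one hv'.ne']
      ring_nf
    rw [h1, ← Real.rpow_mul hv'.le, mul_div_cancel₀ _ hq', ← mul_assoc, ← Real.rpow_add hv']
    simp

section Implicit

variable {r q : ℝ} {W : ℝ × ℝ → ℝ}

theorem continuousAt_of_implicit (hr : 0 < r) (hq : 0 < q)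
    (hW : ∀ p : ℝ × ℝ, 0 < p.2 → |W p| ^ r * W p + p.2 * q * W p = p.1)
    {p : ℝ × ℝ} (hp : 0 < p.2) : ContinuousAt W p := by
  have hlim : Tendsto (fun x : ℝ × ℝ => |x.1 - |W p| ^ r * W p - x.2 * q * W p| / (x.2 * q))
      (nhds p) (nhds 0) := by
    have hc : ContinuousAt
        (fun x : ℝ × ℝ => |x.1 - |W p| ^ r * W p - x.2 * q * W p| / (x.2 * q)) p := by
      refine ContinuousAt.div (by fun_prop) (by fun_prop) (by positivity)
    have h0 : p.1 - |W p| ^ r * W p - p.2 * q * W p = 0 := by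
      linarith [hW p hp]
    simpa [ContinuousAt, h0] using hc
  rw [ContinuousAt, tendsto_iff_dist_tendsto_zero]
  refine squeeze_zero' (Eventually.of_forall fun _ => dist_nonneg) ?_ hlim
  have hpos : ∀ᶠ x : ℝ × ℝ in nhds p, 0 < x.2 := continuous_snd.continuousAt.eventually_const_lt hp
  filter_upwards [hpos] with x hx
  rw [Real.dist_eq, le_div_iff₀ (by positivity)]
  have hxq : 0 < x.2 * q := by positivity
  have e := hW x hx
  rcases le_total (W x) (W p) with h | h
  · have hm : |W x| ^ r * W x ≤ |W p| ^ r * W p := monotone_abs_rpow_mul_self hr h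
    rw [abs_of_nonpos (sub_nonpos.mpr h)]
    refine le_trans ?_ (neg_le_abs _)
    linarith
  · have hm : |W p| ^ r * W p ≤ |W x| ^ r * W x := monotone_abs_rpow_mul_self hr h
    rw [abs_of_nonneg (sub_nonneg.mpr h)]
    refine le_trans ?_ (le_abs_self _)
    linarith

/-- The shear `(a, b) ↦ (D a + c b, b)` of the plane, with `D ≠ 0`. -/
def shearEquiv (D c : ℝ) (hD : D ≠ 0) : (ℝ × ℝ) ≃L[ℝ] (ℝ × ℝ) :=
  ContinuousLinearEquiv.equivOfInverse
    ((D • ContinuousLinearMap.fst ℝ ℝ ℝ + c • ContinuousLinearMap.snd ℝ ℝ ℝ).prod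
      (ContinuousLinearMap.snd ℝ ℝ ℝ))
    ((D⁻¹ • ContinuousLinearMap.fst ℝ ℝ ℝ - (D⁻¹ * c) • ContinuousLinearMap.snd ℝ ℝ ℝ).prod
      (ContinuousLinearMap.snd ℝ ℝ ℝ))
    (fun x => by ext <;> simp; field_simp; ring)
    (fun x => by ext <;> simp; field_simp; ring)

theorem hasFDerivAt_of_implicit (hr : 0 < r) (hq : 0 < q)
    (hW : ∀ p : ℝ × ℝ, 0 < p.2 → |W p| ^ r * W p + p.2 * q * W p = p.1)
    {p : ℝ × ℝ} (hp : 0 < p.2) :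
    HasFDerivAt W (((r + 1) * |W p| ^ r + p.2 * q)⁻¹ • ContinuousLinearMap.fst ℝ ℝ ℝ -
      (((r + 1) * |W p| ^ r + p.2 * q)⁻¹ * (q * W p)) • ContinuousLinearMap.snd ℝ ℝ ℝ) p := by
  have hD : (r + 1) * |W p| ^ r + p.2 * q ≠ 0 := by positivity
  have hΦ : HasFDerivAt (fun x : ℝ × ℝ => (|x.1| ^ r * x.1 + x.2 * q * x.1, x.2))
      (shearEquiv _ (q * W p) hD : (ℝ × ℝ) →L[ℝ] (ℝ × ℝ)) (W p, p.2) := by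
    have h1 : HasFDerivAt (fun x : ℝ × ℝ => |x.1| ^ r * x.1) _ (W p, p.2) :=
      (hasDerivAt_abs_rpow_mul_self hr (W p)).comp_hasFDerivAt (f := Prod.fst) (W p, p.2)
        (hasFDerivAt_fst (𝕜 := ℝ))
    have hs : HasFDerivAt (fun x : ℝ × ℝ => x.2) _ (W p, p.2) := hasFDerivAt_snd (𝕜 := ℝ)
    have hf : HasFDerivAt (fun x : ℝ × ℝ => x.1) _ (W p, p.2) := hasFDerivAt_fst (𝕜 := ℝ)
    have h2 := (hs.mul_const q).mul hf
    refine ((h1.add h2).prodMk hs).congr_fderiv ?_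
    ext <;> simp [shearEquiv, ContinuousLinearEquiv.equivOfInverse]
    ring
  have hc : ContinuousAt (fun x : ℝ × ℝ => (W x, x.2)) p :=
    (continuousAt_of_implicit hr hq hW hp).prodMk continuous_snd.continuousAt
  have hpos : ∀ᶠ x : ℝ × ℝ in nhds p, 0 < x.2 := continuous_snd.continuousAt.eventually_const_lt hp
  have hinv := HasFDerivAt.of_local_left_inverse (f := fun x : ℝ × ℝ =>
    (|x.1| ^ r * x.1 + x.2 * q * x.1, x.2)) (g := fun x => (W x, x.2)) hc hΦ
    (hpos.mono fun x hx => Prod.ext (hW x hx) rfl)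
  exact hinv.fst

end Implicit

/-- For `q ∈ (1,2)`, `(u,χ) ↦ η_q(u;χ)` is differentiable at every point of `ℝ × (0,∞)`
with continuous partial derivatives there; moreover for every fixed `χ > 0` the function
`u ↦ ∂₂η_q(u;χ)` is differentiable at every `u ∈ ℝ`. -/
theorem eta_q_smoothness
    (q : ℝ) (hq1 : 1 < q) (hq2 : q < 2)
    (η : ℝ → ℝ → ℝ) (hη : ∀ u χ, 0 ≤ χ → IsProx q χ u (η u χ)) :
    (∀ u χ : ℝ, 0 < χ → DifferentiableAt ℝ (fun p : ℝ × ℝ => η p.1 p.2) (u, χ)) ∧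
    ContinuousOn (fun p : ℝ × ℝ => deriv (fun v => η v p.2) p.1)
      ((univ : Set ℝ) ×ˢ Ioi (0:ℝ)) ∧
    ContinuousOn (fun p : ℝ × ℝ => deriv (fun c => η p.1 c) p.2)
      ((univ : Set ℝ) ×ˢ Ioi (0:ℝ)) ∧
    (∀ χ : ℝ, 0 < χ → ∀ u : ℝ,
      DifferentiableAt ℝ (fun v => deriv (fun c => η v c) χ) u) := by
  have hq : 0 < q := by linarith
  obtain ⟨r, hr, hrq⟩ : ∃ r : ℝ, 0 < r ∧ r = (2 - q) / (q - 1) :=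
    ⟨_, div_pos (by linarith) (by linarith), rfl⟩
  obtain ⟨W, hWdef⟩ : ∃ W : ℝ × ℝ → ℝ,
      ∀ p, W p = |η p.1 p.2| ^ (q - 2) * η p.1 p.2 := ⟨_, fun _ => rfl⟩
  have hηW : ∀ p : ℝ × ℝ, |W p| ^ r * W p = η p.1 p.2 := fun p => by
    rw [hWdef, hrq, abs_rpow_mul_self_inverse hq1]
  have hW : ∀ p : ℝ × ℝ, 0 < p.2 → |W p| ^ r * W p + p.2 * q * W p = p.1 := fun p hp => by
    rw [hηW, hWdef, ← (hη p.1 p.2 hp.le).eq_add hq1]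
  have hfd : ∀ p : ℝ × ℝ, 0 < p.2 → HasFDerivAt (fun p : ℝ × ℝ => η p.1 p.2) _ p := fun p hp =>
    ((hasDerivAt_abs_rpow_mul_self hr (W p)).comp_hasFDerivAt p
      (hasFDerivAt_of_implicit hr hq hW hp)).congr_of_eventuallyEq
      (Eventually.of_forall fun x => (hηW x).symm)
  have hd1 : ∀ p : ℝ × ℝ, 0 < p.2 → deriv (fun v => η v p.2) p.1 =
      (r + 1) * |W p| ^ r * ((r + 1) * |W p| ^ r + p.2 * q)⁻¹ := fun p hp => by
    have h := (hfd p hp).comp_hasDerivAt p.1 ((hasDerivAt_id' p.1).prodMk (hasDerivAt_const p.1 p.2))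
    refine h.deriv.trans ?_
    simp
  have hd2 : ∀ p : ℝ × ℝ, 0 < p.2 → deriv (fun c => η p.1 c) p.2 =
      -q * (((r + 1) * |W p| ^ r * ((r + 1) * |W p| ^ r + p.2 * q)⁻¹) * W p) := fun p hp => by
    have h := (hfd p hp).comp_hasDerivAt p.2 ((hasDerivAt_const p.2 p.1).prodMk (hasDerivAt_id' p.2))
    refine h.deriv.trans ?_
    simp
    ring
  have hWc : ContinuousOn W ((univ : Set ℝ) ×ˢ Ioi (0:ℝ)) := fun p hp =>
    (continuousAt_of_implicit hr hq hW hp.2).continuousWithinAt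
  have hac : ContinuousOn (fun p => |W p| ^ r) ((univ : Set ℝ) ×ˢ Ioi (0:ℝ)) :=
    (continuous_abs_rpow hr).comp_continuousOn hWc
  have hcoef : ContinuousOn
      (fun p : ℝ × ℝ => (r + 1) * |W p| ^ r * ((r + 1) * |W p| ^ r + p.2 * q)⁻¹)
      ((univ : Set ℝ) ×ˢ Ioi (0:ℝ)) := by
    refine (continuousOn_const.mul hac).mul (ContinuousOn.inv₀
      ((continuousOn_const.mul hac).add (by fun_prop)) fun p hp => ?_)
    have : 0 < p.2 := hp.2
    positivity
  refine ⟨fun u χ hχ => (hfd (u, χ) hχ).differentiableAt,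
    hcoef.congr fun p hp => hd1 p hp.2,
    (continuousOn_const.mul (hcoef.mul hWc)).congr fun p hp => hd2 p hp.2, fun χ hχ u => ?_⟩
  have hg : DifferentiableAt ℝ
      (fun w : ℝ => (r + 1) * |w| ^ r * ((r + 1) * |w| ^ r + χ * q)⁻¹ * w) (W (u, χ)) := by
    rcases eq_or_ne (W (u, χ)) 0 with h0 | h0
    · rw [h0]
      have ha := (continuous_abs_rpow hr).continuousAt (x := 0)
      refine (hasDerivAt_mul_self_zero
        (h := fun w : ℝ => (r + 1) * |w| ^ r * ((r + 1) * |w| ^ r + χ * q)⁻¹)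
        ((continuousAt_const.mul ha).mul (ContinuousAt.inv₀
          ((continuousAt_const.mul ha).add continuousAt_const) ?_))).differentiableAt
      positivity
    · have ha := (differentiableAt_abs_rpow_of_ne (r := r) h0).const_mul (r + 1)
      refine (ha.mul ((ha.add_const (χ * q)).inv ?_)).mul differentiableAt_id
      positivity
  have hWu : DifferentiableAt ℝ (fun v => W (v, χ)) u :=
    ((hasFDerivAt_of_implicit hr hq hW (p := (u, χ)) hχ).comp_hasDerivAt u
      ((hasDerivAt_id' u).prodMk (hasDerivAt_const u χ))).differentiableAt
  have heq : (fun v => deriv (fun c => η v c) χ) = fun v =>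
      -q * (((r + 1) * |W (v, χ)| ^ r * ((r + 1) * |W (v, χ)| ^ r + χ * q)⁻¹) * W (v, χ)) :=
    funext fun v => hd2 (v, χ) hχ
  rw [heq]
  exact (hg.comp u hWu).const_mul (-q)
end
end

section
/- Let q ∈ (1,2) and χ > 0. Then: (i) for every u ≠ 0, ∂₁η_q(u;χ) = 1/(1 + χq(q−1)|η_q(u;χ)|^{q−2}); (ii) for every u ≠ 0, ∂₂η_q(u;χ) = −q|η_q(u;χ)|^{q−1}·sign(u) / (1 + χq(q−1)|η_q(u;χ)|^{q−2}); (iii) 0 ≤ ∂₁η_q(u;χ) ≤ 1 for every u ∈ ℝ, with ∂₁η_q(0;χ) = 0; (iv) for every u > 0, the second derivative ∂₁²η_q(u;χ) exists and is strictly positive. -/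
open Real Set

noncomputable section

/-- The derivative `q|v|^(q-2)v` of `v ↦ |v|^q` for `1 < q`. -/
def absRpowDeriv (q v : ℝ) : ℝ := q * |v| ^ (q - 2) * v

lemma abs_rpow_sub_two_mul_abs (q v : ℝ) (hv : v ≠ 0) : |v| ^ (q - 2) * |v| = |v| ^ (q - 1) := by
  rw [← rpow_add_one (abs_ne_zero.mpr hv)]
  ring_nf

lemma absRpowDeriv_monotone {q : ℝ} (hq : 1 < q) : Monotone (absRpowDeriv q) := by
  have hconv : ConvexOn ℝ univ (fun x : ℝ => |x| ^ q) := by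
    refine ConvexOn.comp (g := fun x : ℝ => x ^ q) (f := fun x : ℝ => |x|) ?_ ?_ ?_
    · have himg : (fun x : ℝ => |x|) '' univ = Ici 0 := by
        ext y
        simp only [image_univ, mem_range, mem_Ici]
        exact ⟨fun ⟨x, hx⟩ => hx ▸ abs_nonneg x, fun hy => ⟨y, abs_of_nonneg hy⟩⟩
      rw [himg]
      exact convexOn_rpow hq.le
    · exact convexOn_univ_norm (E := ℝ)
    · rintro _ ⟨x, -, rfl⟩ _ ⟨y, -, rfl⟩ hxy
      exact rpow_le_rpow (abs_nonneg x) hxy (by linarith)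
  have hmono := hconv.monotoneOn_deriv
    fun x _ => (hasDerivAt_abs_rpow x hq).differentiableAt
  intro x y hxy
  have h := hmono (mem_univ x) (mem_univ y) hxy
  rwa [(hasDerivAt_abs_rpow x hq).deriv, (hasDerivAt_abs_rpow y hq).deriv] at h

lemma hasDerivAt_absRpowDeriv (q : ℝ) {v : ℝ} (hv : v ≠ 0) :
    HasDerivAt (absRpowDeriv q) (q * (q - 1) * |v| ^ (q - 2)) v := by
  have h := (((hasDerivAt_abs hv).rpow_const (p := q - 2)
    (Or.inl (abs_ne_zero.mpr hv))).const_mul q).mul (hasDerivAt_id v)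
  refine h.congr_deriv ?_
  have hsign : (SignType.sign v : ℝ) * v = |v| := by
    rcases lt_or_gt_of_ne hv with h | h
    · simp [sign_neg h, abs_of_neg h]
    · simp [sign_pos h, abs_of_pos h]
  have hpow : |v| ^ (q - 2 - 1) * |v| = |v| ^ (q - 2) := by
    rw [← rpow_add_one (abs_ne_zero.mpr hv)]
    ring_nf
  simp only [id, mul_one]
  linear_combination q * (q - 2) * |v| ^ (q - 2 - 1) * hsign + q * (q - 2) * hpow

lemma IsProx.stationary {q c u v : ℝ} (hq : 1 < q) (h : IsProx q c u v) :
    v + c * absRpowDeriv q v = u := by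
  have hmin : IsLocalMin (fun z : ℝ => (1/2) * (u - z)^2 + c * |z| ^ q) v :=
    Filter.Eventually.of_forall h
  have hd := ((((hasDerivAt_id v).const_sub u).pow 2).const_mul (1/2 : ℝ)).add
    ((hasDerivAt_abs_rpow v hq).const_mul c)
  have h0 := hmin.hasDerivAt_eq_zero hd
  simp only [id] at h0
  norm_num at h0
  unfold absRpowDeriv
  linarith

lemma abs_sub_le_of_stationary {q c c' u u' v v' : ℝ} (hq : 1 < q) (hc : 0 ≤ c)
    (h : v + c * absRpowDeriv q v = u) (h' : v' + c' * absRpowDeriv q v' = u') :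
    |v - v'| ≤ |u - u'| + |c - c'| * |absRpowDeriv q v'| := by
  have key : (v - v') + c * (absRpowDeriv q v - absRpowDeriv q v')
      = (u - u') - (c - c') * absRpowDeriv q v' := by linear_combination h - h'
  have hle : |v - v'| ≤ |(v - v') + c * (absRpowDeriv q v - absRpowDeriv q v')| := by
    rcases le_total v v' with hv | hv
    · have := mul_nonneg hc (sub_nonneg.mpr (absRpowDeriv_monotone hq hv))
      rw [abs_of_nonpos (by linarith), abs_of_nonpos (by linarith)]
      linarith
    · have := mul_nonneg hc (sub_nonneg.mpr (absRpowDeriv_monotone hq hv))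
      rw [abs_of_nonneg (by linarith), abs_of_nonneg (by linarith)]
      linarith
  rw [key] at hle
  calc |v - v'| ≤ _ := hle
    _ ≤ |u - u'| + |(c - c') * absRpowDeriv q v'| := abs_sub _ _
    _ = _ := by rw [abs_mul]

lemma stationary_factor {q c u v : ℝ} (h : v + c * absRpowDeriv q v = u) :
    (1 + c * (q * |v| ^ (q - 2))) * v = u := by
  rw [← h, absRpowDeriv]
  ring

lemma one_add_mul_pos {c a v p : ℝ} (hc : 0 ≤ c) (ha : 0 ≤ a) :
    0 < 1 + c * (a * |v| ^ p) := by
  positivity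

lemma ne_zero_of_stationary {q c u v : ℝ} (hu : u ≠ 0)
    (h : v + c * absRpowDeriv q v = u) : v ≠ 0 := by
  rintro rfl
  simp [absRpowDeriv] at h
  exact hu h.symm

lemma pos_of_stationary {q c u v : ℝ} (hq : 0 ≤ q) (hc : 0 ≤ c) (hu : 0 < u)
    (h : v + c * absRpowDeriv q v = u) : 0 < v := by
  rw [← stationary_factor h] at hu
  exact (pos_iff_pos_of_mul_pos hu).mp (one_add_mul_pos hc hq)

lemma neg_of_stationary {q c u v : ℝ} (hq : 0 ≤ q) (hc : 0 ≤ c) (hu : u < 0)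
    (h : v + c * absRpowDeriv q v = u) : v < 0 := by
  rw [← stationary_factor h] at hu
  exact (pos_iff_neg_of_mul_neg hu).mp (one_add_mul_pos hc hq)

lemma absRpowDeriv_eq_mul_sign {q c u v : ℝ} (hq : 0 ≤ q) (hc : 0 ≤ c) (hu : u ≠ 0)
    (h : v + c * absRpowDeriv q v = u) :
    absRpowDeriv q v = q * |v| ^ (q - 1) * Real.sign u := by
  rw [← abs_rpow_sub_two_mul_abs q v (ne_zero_of_stationary hu h), absRpowDeriv]
  rcases lt_or_gt_of_ne hu with hu | hu
  · rw [Real.sign_of_neg hu, abs_of_neg (neg_of_stationary hq hc hu h)]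
    ring
  · rw [Real.sign_of_pos hu, abs_of_pos (pos_of_stationary hq hc hu h)]
    ring

section Solution

variable {q χ : ℝ}

lemma continuous_of_stationary (hq : 1 < q) (hχ : 0 ≤ χ) {f : ℝ → ℝ}
    (hf : ∀ u, f u + χ * absRpowDeriv q (f u) = u) : Continuous f := by
  refine (LipschitzWith.of_dist_le_mul (K := 1) fun x y => ?_).continuous
  have h := abs_sub_le_of_stationary hq hχ (hf x) (hf y)
  simpa [Real.dist_eq] using h

lemma hasDerivAt_of_stationary (hq : 1 < q) (hχ : 0 ≤ χ) {f : ℝ → ℝ}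
    (hf : ∀ u, f u + χ * absRpowDeriv q (f u) = u) {u : ℝ} (hu : u ≠ 0) :
    HasDerivAt f (1 + χ * (q * (q - 1) * |f u| ^ (q - 2)))⁻¹ u := by
  have hne := ne_zero_of_stationary hu (hf u)
  refine HasDerivAt.of_local_left_inverse (f := fun v => v + χ * absRpowDeriv q v)
    (continuous_of_stationary hq hχ hf).continuousAt
    ((hasDerivAt_id _).add ((hasDerivAt_absRpowDeriv q hne).const_mul χ))
    (one_add_mul_pos hχ (by nlinarith)).ne' (Filter.Eventually.of_forall hf)

lemma hasDerivAt_zero_of_stationary (hq1 : 1 < q) (hq2 : q < 2) (hχ : 0 < χ) {f : ℝ → ℝ}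
    (hf : ∀ u, f u + χ * absRpowDeriv q (f u) = u) : HasDerivAt f 0 0 := by
  have h0 : f 0 = 0 := by
    by_contra hne
    have h := stationary_factor (hf 0)
    have := one_add_mul_pos (v := f 0) (p := q - 2) hχ.le (by linarith : 0 ≤ q)
    rcases mul_eq_zero.mp h with h | h
    · linarith
    · exact hne h
  have hbound : ∀ u, ‖f u‖ ≤ ‖(|f u| ^ (2 - q) / (χ * q)) * u‖ := by
    intro u
    rcases eq_or_ne (f u) 0 with h | h
    · rw [h, norm_zero]
      exact norm_nonneg _
    · have hfp : 0 < |f u| := abs_pos.mpr h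
      have hpp : 0 < |f u| ^ (q - 2) := rpow_pos_of_pos hfp _
      have hmul : |f u| ^ (2 - q) * |f u| ^ (q - 2) = 1 := by
        rw [← rpow_add hfp]
        simp
      have hu := congrArg abs (stationary_factor (hf u))
      rw [abs_mul, abs_of_pos (one_add_mul_pos hχ.le (by linarith))] at hu
      have hb : 0 ≤ |f u| ^ (2 - q) / (χ * q) := by positivity
      rw [Real.norm_eq_abs, Real.norm_eq_abs, abs_mul, ← hu, abs_of_nonneg hb,
        div_mul_eq_mul_div, le_div_iff₀ (by positivity)]
      have h2 : 0 ≤ |f u| ^ (2 - q) * |f u| := by positivity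
      linear_combination (-χ * q * |f u|) * hmul + h2
  rw [hasDerivAt_iff_isLittleO]
  simp only [h0, sub_zero, smul_eq_mul, mul_zero]
  refine (Asymptotics.IsBigO.of_bound 1 (Filter.Eventually.of_forall fun u => ?_)).trans_isLittleO
    (g := fun u => (|f u| ^ (2 - q) / (χ * q)) * u) ?_
  · rw [one_mul]
    exact hbound u
  · have hlim : Filter.Tendsto (fun u => |f u| ^ (2 - q) / (χ * q)) (nhds 0) (nhds 0) := by
      have hc : Continuous fun u => |f u| ^ (2 - q) / (χ * q) :=
        ((continuous_of_stationary hq1 hχ.le hf).abs.rpow_const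
          fun _ => Or.inr (by linarith)).div_const _
      have h := hc.tendsto 0
      rwa [h0, abs_zero, zero_rpow (by linarith), zero_div] at h
    simpa using ((Asymptotics.isLittleO_one_iff ℝ).mpr hlim).mul_isBigO
      (Asymptotics.isBigO_refl (fun u : ℝ => u) (nhds 0))

lemma hasDerivAt_weight_of_stationary (hq : 1 < q) (hχ : 0 < χ) {u : ℝ} (hu : u ≠ 0)
    {g : ℝ → ℝ} (hg : ∀ c, 0 ≤ c → g c + c * absRpowDeriv q (g c) = u) :
    HasDerivAt g (-absRpowDeriv q (g χ) / (1 + χ * (q * (q - 1) * |g χ| ^ (q - 2)))) χ := by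
  have hstat := hg χ hχ.le
  have hev : ∀ᶠ c in nhds χ, 0 < c := lt_mem_nhds hχ
  have hD : ∀ v, v ≠ 0 → absRpowDeriv q v ≠ 0 := fun v hv =>
    mul_ne_zero (mul_ne_zero (by linarith) (rpow_pos_of_pos (abs_pos.mpr hv) _).ne') hv
  have hne := ne_zero_of_stationary hu hstat
  have hpos := one_add_mul_pos (v := g χ) (p := q - 2) hχ.le
    (by nlinarith : 0 ≤ q * (q - 1))
  have hcont : ContinuousAt g χ := by
    rw [ContinuousAt, tendsto_iff_dist_tendsto_zero]
    refine squeeze_zero' (Filter.Eventually.of_forall fun _ => dist_nonneg)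
      (g := fun c => |c - χ| * |absRpowDeriv q (g χ)|) ?_ ?_
    · filter_upwards [hev] with c hc
      simpa [Real.dist_eq] using abs_sub_le_of_stationary hq hc.le (hg c hc.le) hstat
    · have h : Continuous fun c => |c - χ| * |absRpowDeriv q (g χ)| := by fun_prop
      simpa using h.tendsto χ
  have hd : HasDerivAt (fun v => (u - v) / absRpowDeriv q v)
      (-(1 + χ * (q * (q - 1) * |g χ| ^ (q - 2))) / absRpowDeriv q (g χ)) (g χ) := by
    refine (((hasDerivAt_id (g χ)).const_sub u).div (hasDerivAt_absRpowDeriv q hne)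
      (hD _ hne)).congr_deriv ?_
    have hsub : u - g χ = χ * absRpowDeriv q (g χ) := by linarith
    have := hD _ hne
    simp only [id, hsub]
    field_simp
    ring
  refine (hd.of_local_left_inverse hcont (div_ne_zero (neg_ne_zero.mpr hpos.ne') (hD _ hne))
    ?_).congr_deriv ?_
  · filter_upwards [hev] with c hc
    have h := hg c hc.le
    rw [div_eq_iff (hD _ (ne_zero_of_stationary hu h))]
    linarith
  · rw [inv_div, div_neg, neg_div]

lemma exists_pos_hasDerivAt_deriv_of_stationary (hq1 : 1 < q) (hq2 : q < 2) (hχ : 0 < χ)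
    {f : ℝ → ℝ} (hf : ∀ u, f u + χ * absRpowDeriv q (f u) = u) {u : ℝ} (hu : 0 < u) :
    ∃ d : ℝ, 0 < d ∧ HasDerivAt (deriv f) d u := by
  have hfu : 0 < f u := pos_of_stationary (by linarith) hχ.le hu (hf u)
  have hpos := fun v => one_add_mul_pos (v := f v) (p := q - 2) hχ.le
    (by nlinarith : 0 ≤ q * (q - 1))
  have hd := ((((((hasDerivAt_abs_pos hfu).comp u
    (hasDerivAt_of_stationary hq1 hχ.le hf hu.ne')).rpow_const (p := q - 2)
    (Or.inl (abs_pos.mpr hfu.ne').ne')).const_mul (q * (q - 1))).const_mul χ).const_add 1).inv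
    (hpos u).ne'
  refine ⟨_, ?_, hd.congr_of_eventuallyEq ?_⟩
  · refine div_pos ?_ (pow_pos (hpos u) 2)
    have h1 := inv_pos.mpr (hpos u)
    have h2 : 0 < |f u| ^ (q - 2 - 1) := rpow_pos_of_pos (abs_pos.mpr hfu.ne') _
    have h3 : 0 < q - 1 := by linarith
    have h4 : 0 < 2 - q := by linarith
    have h5 : 0 < q := by linarith
    have : 0 < χ * (q * (q - 1) * ((1 + χ * (q * (q - 1) * |f u| ^ (q - 2)))⁻¹ *
      (2 - q) * |f u| ^ (q - 2 - 1))) := by positivity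
    simp only [Function.comp_apply]
    linarith
  · filter_upwards [lt_mem_nhds hu] with v hv
    exact (hasDerivAt_of_stationary hq1 hχ.le hf hv.ne').deriv

end Solution

/-- For `q ∈ (1,2)` and `χ > 0`:
(i) for `u ≠ 0`, `∂₁η_q(u;χ) = 1/(1 + χq(q−1)|η_q(u;χ)|^{q−2})`;
(ii) for `u ≠ 0`, `∂₂η_q(u;χ) = −q|η_q(u;χ)|^{q−1}sign(u)/(1 + χq(q−1)|η_q(u;χ)|^{q−2})`;
(iii) `0 ≤ ∂₁η_q(u;χ) ≤ 1` for all `u`, with `∂₁η_q(0;χ) = 0`;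
(iv) for `u > 0`, the second derivative `∂₁²η_q(u;χ)` exists and is strictly positive. -/
theorem eta_q_derivative_formulas
    (q χ : ℝ) (hq1 : 1 < q) (hq2 : q < 2) (hχ : 0 < χ)
    (η : ℝ → ℝ → ℝ) (hη : ∀ u c, 0 ≤ c → IsProx q c u (η u c)) :
    (∀ u : ℝ, u ≠ 0 →
      deriv (fun v => η v χ) u = 1 / (1 + χ * q * (q - 1) * |η u χ| ^ (q - 2))) ∧
    (∀ u : ℝ, u ≠ 0 →
      deriv (fun c => η u c) χ =
        -(q * |η u χ| ^ (q - 1) * Real.sign u) /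
          (1 + χ * q * (q - 1) * |η u χ| ^ (q - 2))) ∧
    (∀ u : ℝ, 0 ≤ deriv (fun v => η v χ) u ∧ deriv (fun v => η v χ) u ≤ 1) ∧
    deriv (fun v => η v χ) 0 = 0 ∧
    (∀ u : ℝ, 0 < u → ∃ d : ℝ, 0 < d ∧
      HasDerivAt (fun v => deriv (fun w => η w χ) v) d u) := by
  have hstat : ∀ u c, 0 ≤ c → η u c + c * absRpowDeriv q (η u c) = u :=
    fun u c hc => (hη u c hc).stationary hq1
  have hf : ∀ u, η u χ + χ * absRpowDeriv q (η u χ) = u := fun u => hstat u χ hχ.le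
  have hzero : deriv (fun v => η v χ) 0 = 0 :=
    (hasDerivAt_zero_of_stationary (f := fun v => η v χ) hq1 hq2 hχ hf).deriv
  have hden : ∀ u, 1 + χ * q * (q - 1) * |η u χ| ^ (q - 2)
      = 1 + χ * (q * (q - 1) * |η u χ| ^ (q - 2)) := fun u => by ring
  have hfirst : ∀ u : ℝ, u ≠ 0 →
      deriv (fun v => η v χ) u = 1 / (1 + χ * q * (q - 1) * |η u χ| ^ (q - 2)) := by
    intro u hu
    rw [hden, one_div]
    exact (hasDerivAt_of_stationary (f := fun v => η v χ) hq1 hχ.le hf hu).deriv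
  refine ⟨hfirst, fun u hu => ?_, fun u => ?_, hzero, fun u hu =>
    exists_pos_hasDerivAt_deriv_of_stationary (f := fun v => η v χ) hq1 hq2 hχ hf hu⟩
  · rw [hden, ← absRpowDeriv_eq_mul_sign (by linarith) hχ.le hu (hf u)]
    exact (hasDerivAt_weight_of_stationary hq1 hχ hu (hstat u)).deriv
  · rcases eq_or_ne u 0 with rfl | hu
    · rw [hzero]
      exact ⟨le_rfl, zero_le_one⟩
    · have h : 0 ≤ χ * q * (q - 1) * |η u χ| ^ (q - 2) := by
        have : 0 < q - 1 := by linarith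
        have : 0 < q := by linarith
        positivity
      rw [hfirst u hu]
      exact ⟨by positivity, div_le_one_of_le₀ (by linarith) (by linarith)⟩
end
end
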